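/- arXiv:2301.08203 — 7 statements merged into one kernel-verified Lean document; each statement's English description precedes it below -/
import Mathlib

section
/- Let d ≥ 1 and λ : Fin d → ℝ with λ j ≠ 0 for every j, and assume there is at least one j with λ j < 0. Let λ* denote the largest of the strictly negative values λ j, and let ρ > −1/λ*. If x : ℝ → (Fin d → ℝ) is differentiable and satisfies (x j)'(t) = −λ j · (1 + ρ · λ j) · x j t for every j and t, then x t tends to 0 as t → ∞; that is, the deterministic USAM flow converges to the saddle (or maximum) at the origin. -/
/-- Solutions of the scalar linear equation `y' = c * y` are exponentials. -/
theorem eq_exp_mul_of_hasDerivAt {c : ℝ} {y : ℝ → ℝ}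
    (hy : ∀ t, HasDerivAt y (c * y t) t) (t : ℝ) : y t = Real.exp (c * t) * y 0 := by
  have hderiv : ∀ s, HasDerivAt (fun s => Real.exp (-(c * s)) * y s) 0 s := fun s => by
    have hexp : HasDerivAt (fun s => Real.exp (-(c * s))) (Real.exp (-(c * s)) * -(c * 1)) s :=
      ((hasDerivAt_id s).const_mul c).neg.exp
    exact (hexp.mul (hy s)).congr_deriv (by ring)
  have hconst := is_const_of_deriv_eq_zero (fun s => (hderiv s).differentiableAt)
    (fun s => (hderiv s).deriv) t 0
  simp only [mul_zero, neg_zero, Real.exp_zero, one_mul] at hconst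
  rw [← hconst, ← mul_assoc, ← Real.exp_add, add_neg_cancel, Real.exp_zero, one_mul]

/-- Solutions of `y' = c * y` with `c < 0` decay to zero. -/
theorem tendsto_zero_of_hasDerivAt_mul_neg {c : ℝ} {y : ℝ → ℝ} (hc : c < 0)
    (hy : ∀ t, HasDerivAt y (c * y t) t) : Filter.Tendsto y Filter.atTop (nhds 0) := by
  have hexp : Filter.Tendsto (fun t => Real.exp (c * t) * y 0) Filter.atTop (nhds (0 * y 0)) :=
    (Real.tendsto_exp_atBot.comp
      (Filter.tendsto_id.const_mul_atTop_of_neg hc)).mul_const (y 0)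
  rw [zero_mul] at hexp
  exact hexp.congr fun t => (eq_exp_mul_of_hasDerivAt hy t).symm


/-- Lemma USAM_Quad_Ind: if `H` has a strictly negative eigenvalue and
`ρ > -1/λ*` where `λ*` is the largest strictly negative eigenvalue, the deterministic
USAM flow on the quadratic loss converges to the critical point at the origin. -/
theorem usam_ode_quadratic_indefinite_tendsto_zero
    (d : ℕ) (hd : 1 ≤ d) (lam : Fin d → ℝ) (hne : ∀ j, lam j ≠ 0)
    (lamstar : ℝ)
    (hstar_mem : ∃ j, lam j = lamstar) (hstar_neg : lamstar < 0)
    (hstar_max : ∀ j, lam j < 0 → lam j ≤ lamstar)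
    (ρ : ℝ) (hρ : -1 / lamstar < ρ)
    (x : ℝ → Fin d → ℝ)
    (hdiff : ∀ j, Differentiable ℝ (fun t => x t j))
    (hode : ∀ j t, HasDerivAt (fun s => x s j)
      (-(lam j) * (1 + ρ * lam j) * x t j) t) :
    Filter.Tendsto x Filter.atTop (nhds 0) := by
  have hρl : ρ * lamstar < -1 := (div_lt_iff_of_neg hstar_neg).mp hρ
  have hρ_pos : 0 < ρ := (div_pos_of_neg_of_neg (by norm_num) hstar_neg).trans hρ
  rw [tendsto_pi_nhds]
  intro j
  refine tendsto_zero_of_hasDerivAt_mul_neg ?_ (hode j)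
  rcases lt_or_gt_of_ne (hne j) with hneg | hpos
  · have hle : ρ * lam j ≤ ρ * lamstar :=
      mul_le_mul_of_nonneg_left (hstar_max j hneg) hρ_pos.le
    exact mul_neg_of_pos_of_neg (neg_pos.mpr hneg) (by linarith)
  · exact mul_neg_of_neg_of_pos (neg_neg_of_pos hpos) (by positivity)
end

section
/- Let d ≥ 1 and λ : Fin d → ℝ, let ρ > 0, and assume there is at least one j with λ j < 0; let λ* denote the largest of the strictly negative values λ j. Let H be the diagonal linear map (H x) j = λ j · x j on ℝ^d. Then for every x with 0 < ‖Hx‖ ≤ −ρ·λ*, one has Σ_j λ j · (1 + ρ · λ j/‖Hx‖) · (x j)² ≥ 0. -/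
/-- indefinite part of Lemma SAM_ODE_Converg: if `λ*` is the largest
strictly negative eigenvalue and `0 < ‖Hx‖ ≤ -ρ λ*`, then the Lyapunov quantity
`∑ j, λ j (1 + ρ λ j / ‖Hx‖) (x j)²` is nonnegative. -/
theorem sam_ode_quadratic_indefinite_lyapunov
    (d : ℕ) (hd : 1 ≤ d) (lam : Fin d → ℝ) (ρ : ℝ) (hρ : 0 < ρ)
    (lamstar : ℝ)
    (hstar_mem : ∃ j, lam j = lamstar) (hstar_neg : lamstar < 0)
    (hstar_max : ∀ j, lam j < 0 → lam j ≤ lamstar)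
    (H : EuclideanSpace ℝ (Fin d) → EuclideanSpace ℝ (Fin d))
    (hH : ∀ x j, H x j = lam j * x j) :
    ∀ x : EuclideanSpace ℝ (Fin d), 0 < ‖H x‖ → ‖H x‖ ≤ -(ρ * lamstar) →
      0 ≤ ∑ j, lam j * (1 + ρ * lam j / ‖H x‖) * (x j) ^ 2 := by
  intro x hx hle
  refine Finset.sum_nonneg fun j _ => mul_nonneg ?_ (sq_nonneg _)
  rcases le_or_gt 0 (lam j) with h | h
  · positivity
  · refine mul_nonneg_of_nonpos_of_nonpos h.le ?_
    have hmul : ρ * lam j ≤ ρ * lamstar := mul_le_mul_of_nonneg_left (hstar_max j h) hρ.le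
    have hdiv : ρ * lam j / ‖H x‖ ≤ -1 := by
      rw [div_le_iff₀ hx]
      linarith
    linarith
end

section
/- Let d ≥ 1 and λ : Fin d → ℝ, let ρ > 0, and assume there is at least one j with λ j < 0; let λ* denote the largest of the strictly negative values λ j. Let H be the diagonal linear map (H x) j = λ j · x j. Suppose x : ℝ → ℝ^d is differentiable on an interval I and satisfies the SAM ODE x'(t) = −(H (x t) + ρ · H(H(x t))/‖H (x t)‖) with 0 < ‖H (x t)‖ ≤ −ρ·λ* for all t ∈ I. Then the function t ↦ ‖x t‖² is nonincreasing (antitone) on I. -/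
/-- trajectory form of Lemma SAM_ODE_Converg: along a SAM trajectory
staying in the region `0 < ‖Hx‖ ≤ -ρ λ*`, the squared norm `‖x t‖²` is nonincreasing. -/
theorem sam_ode_quadratic_norm_sq_antitone
    (d : ℕ) (hd : 1 ≤ d) (lam : Fin d → ℝ) (ρ : ℝ) (hρ : 0 < ρ)
    (lamstar : ℝ)
    (hstar_mem : ∃ j, lam j = lamstar) (hstar_neg : lamstar < 0)
    (hstar_max : ∀ j, lam j < 0 → lam j ≤ lamstar)
    (H : EuclideanSpace ℝ (Fin d) → EuclideanSpace ℝ (Fin d))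
    (hH : ∀ x j, H x j = lam j * x j)
    (I : Set ℝ) (hI : I.OrdConnected)
    (x : ℝ → EuclideanSpace ℝ (Fin d))
    (hx : ∀ t ∈ I, HasDerivWithinAt x
      (-(H (x t) + (ρ / ‖H (x t)‖) • H (H (x t)))) I t)
    (hregion : ∀ t ∈ I, 0 < ‖H (x t)‖ ∧ ‖H (x t)‖ ≤ -(ρ * lamstar)) :
    AntitoneOn (fun t => ‖x t‖ ^ 2) I := by
  refine antitoneOn_of_hasDerivWithinAt_nonpos hI.convex
    (fun t ht => (hx t ht).norm_sq.continuousWithinAt)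
    (fun t ht => (hx t (interior_subset ht)).norm_sq.mono interior_subset) fun t ht => ?_
  obtain ⟨hpos, hle⟩ := hregion t (interior_subset ht)
  set n := ‖H (x t)‖
  have hcoef : ∀ j, 0 ≤ lam j * (1 + ρ / n * lam j) := fun j => by
    rcases le_or_gt 0 (lam j) with h | h
    · positivity
    · refine mul_nonneg_of_nonpos_of_nonpos h.le ?_
      have hn : n ≤ -(ρ * lam j) :=
        hle.trans (neg_le_neg (mul_le_mul_of_nonneg_left (hstar_max j h) hρ.le))
      have heq : 1 + ρ / n * lam j = (n + ρ * lam j) / n := by field_simp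
      rw [heq]
      exact div_nonpos_of_nonpos_of_nonneg (by linarith) hpos.le
  have hinner : 0 ≤ inner ℝ (x t) (H (x t) + (ρ / n) • H (H (x t))) := by
    rw [PiLp.inner_apply]
    refine Finset.sum_nonneg fun j _ => ?_
    have heq : inner ℝ (x t j) ((H (x t) + (ρ / n) • H (H (x t))) j) =
        lam j * (1 + ρ / n * lam j) * x t j ^ 2 := by
      simp only [PiLp.add_apply, PiLp.smul_apply, hH, smul_eq_mul, RCLike.inner_apply, conj_trivial]
      ring
    rw [heq]
    exact mul_nonneg (hcoef j) (sq_nonneg _)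
  rw [inner_neg_right]
  linarith
end

section
/- Let λ < 0 and ρ > −1/λ, and let η > 0, ς > 0. Set θ = λ(1 + ρλ), D = η ς² (1 + ρλ)²/2, and define p : ℝ → ℝ by p(x) = √(λ/(π η ς² (1 + ρλ))) · exp(−λ x²/(η ς² (1 + ρλ))) (well-defined since λ/(1+ρλ) > 0). Then θ > 0, (i) ∫_ℝ p(x) dx = 1, and (ii) for every x ∈ ℝ, d/dx (θ · x · p(x)) + D · p''(x) = 0. -/
theorem hasDerivAt_const_mul_exp_neg_mul_sq (C a x : ℝ) :
    HasDerivAt (fun y : ℝ => C * Real.exp (-a * y ^ 2))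
      (-(2 * a) * (x * (C * Real.exp (-a * x ^ 2)))) x := by
  have h : HasDerivAt (fun y : ℝ => -a * y ^ 2) (-a * (2 * x)) x := by
    simpa using (hasDerivAt_pow 2 x).const_mul (-a)
  exact (h.exp.const_mul C).congr_deriv (by ring)

theorem integral_sqrt_mul_exp_neg_mul_sq {a : ℝ} (ha : 0 < a) :
    ∫ x : ℝ, Real.sqrt (a / Real.pi) * Real.exp (-a * x ^ 2) = 1 := by
  rw [MeasureTheory.integral_const_mul, integral_gaussian, ← Real.sqrt_mul (by positivity),
    div_mul_div_cancel₀ Real.pi_ne_zero, div_self ha.ne', Real.sqrt_one]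

/-- The Gaussian `C * exp (-a x²)` solves the stationary Fokker–Planck equation with drift rate
`2 a D` and diffusion coefficient `D`. -/
theorem deriv_drift_add_diffusion_gaussian (C a D x : ℝ) :
    deriv (fun y : ℝ => D * (2 * a) * y * (C * Real.exp (-a * y ^ 2))) x +
      D * deriv (deriv fun y : ℝ => C * Real.exp (-a * y ^ 2)) x = 0 := by
  have h : (deriv fun y : ℝ => C * Real.exp (-a * y ^ 2)) =
      fun y => -(2 * a) * (y * (C * Real.exp (-a * y ^ 2))) :=
    funext fun y => (hasDerivAt_const_mul_exp_neg_mul_sq C a y).deriv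
  have h' := (hasDerivAt_id' x).mul (hasDerivAt_const_mul_exp_neg_mul_sq C a x)
  have hdrift := (h'.const_mul (D * (2 * a))).deriv
  have hdiff := (h'.const_mul (-(2 * a))).deriv
  simp only [Pi.mul_apply] at hdrift hdiff
  simp only [h, mul_assoc] at hdrift hdiff ⊢
  rw [hdrift, hdiff]
  ring

/-- Theorem USAM_stat_distr_quad_Indef: for `λ < 0` and `ρ > -1/λ`, the
drift rate `θ = λ(1+ρλ)` is positive, and the stated Gaussian density is a probability
density solving the stationary Fokker–Planck equation of the USAM diffusion around the
saddle/maximum direction. -/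
theorem usam_stationary_distribution_indefinite
    (lam ρ η ς : ℝ) (hlam : lam < 0) (hρ : -1 / lam < ρ) (hη : 0 < η) (hς : 0 < ς)
    (θ D : ℝ) (hθ : θ = lam * (1 + ρ * lam))
    (hD : D = η * ς ^ 2 * (1 + ρ * lam) ^ 2 / 2)
    (p : ℝ → ℝ)
    (hp : ∀ x, p x = Real.sqrt (lam / (Real.pi * η * ς ^ 2 * (1 + ρ * lam))) *
      Real.exp (-(lam * x ^ 2) / (η * ς ^ 2 * (1 + ρ * lam)))) :
    0 < θ ∧ (∫ x : ℝ, p x) = 1 ∧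
      ∀ x : ℝ, deriv (fun y => θ * y * p y) x + D * deriv (deriv p) x = 0 := by
  have hs : 1 + ρ * lam < 0 := by
    rw [div_lt_iff_of_neg hlam] at hρ
    linarith
  have hθ_pos : 0 < θ := hθ ▸ mul_pos_of_neg_of_neg hlam hs
  have hK : η * ς ^ 2 * (1 + ρ * lam) < 0 := mul_neg_of_pos_of_neg (by positivity) hs
  obtain ⟨a, ha⟩ : ∃ a, a = lam / (η * ς ^ 2 * (1 + ρ * lam)) := ⟨_, rfl⟩
  have ha_pos : 0 < a := ha ▸ div_pos_of_neg_of_neg hlam hK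
  have hp' : p = fun x => Real.sqrt (a / Real.pi) * Real.exp (-a * x ^ 2) := by
    funext x
    rw [hp x, ha, div_div]
    congr 3 <;> ring
  have hθD : θ = D * (2 * a) := by
    have := hs.ne
    rw [hθ, hD, ha]
    field_simp
  refine ⟨hθ_pos, ?_, fun x => ?_⟩
  · rw [hp']
    exact integral_sqrt_mul_exp_neg_mul_sq ha_pos
  · rw [hp', hθD]
    exact deriv_drift_add_diffusion_gaussian _ a D x
end

section
/- Let d ≥ 1, λ : Fin d → ℝ with λ i ≠ 0 for all i, let k : Fin d → ℝ with k i > 0 for all i, and let ρ > 0, η > 0, ς > 0. Let H be the diagonal map (Hx) i = λ i · x i, and define G : ℝ^d \ {0} → ℝ by G(x) = ½ Σ_i k i (x i)² + Σ_i k i λ i (1 + ρ λ i/‖Hx‖)(x i)² − (η ς²/2) Σ_i k i (1 + ρ λ i/‖Hx‖)². Then G(x) → −∞ as x → 0 with x ≠ 0; in particular, there exists ε > 0 such that G(x) < 0 whenever 0 < ‖x‖ < ε. -/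
open Filter Topology

lemma tendsto_one_add_mul_sq_atTop {a : ℝ} (ha : a ≠ 0) :
    Tendsto (fun u : ℝ => (1 + a * u) ^ 2) atTop atTop := by
  have hlin : Tendsto (fun u : ℝ => a ^ 2 * u + 2 * a) atTop atTop :=
    tendsto_atTop_add_const_right _ _ (tendsto_id.const_mul_atTop (by positivity))
  exact (tendsto_atTop_add_const_left _ 1 (tendsto_id.atTop_mul_atTop₀ hlin)).congr
    fun u => by simp only [id]; ring

lemma tendsto_norm_inv_diagonal_atTop {ι : Type*} [Fintype ι] {lam : ι → ℝ}
    (hlam : ∀ i, lam i ≠ 0) {H : EuclideanSpace ℝ ι → EuclideanSpace ℝ ι}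
    (hH : ∀ x i, H x i = lam i * x i) :
    Tendsto (fun x => ‖H x‖⁻¹) (𝓝[≠] 0) atTop := by
  refine Tendsto.inv_tendsto_nhdsGT_zero (tendsto_nhdsWithin_iff.2 ⟨?_, ?_⟩)
  · have hcont : Continuous fun x => ‖H x‖ := by
      simp only [EuclideanSpace.norm_eq, hH]
      fun_prop
    have hzero : H 0 = 0 := by ext i; simp [hH]
    simpa [hzero] using (hcont.tendsto 0).mono_left nhdsWithin_le_nhds
  · filter_upwards [self_mem_nhdsWithin] with x hx
    refine norm_pos_iff.2 fun h => hx ?_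
    ext i
    have hi := hH x i
    rw [h] at hi
    simpa [hlam i] using hi.symm

lemma quadratic_drift_le {c : ℝ} (hc : 0 < c) (l w y : ℝ) :
    l * w * y - c * w ^ 2 ≤ l ^ 2 * y ^ 2 / (2 * c) - c / 2 * w ^ 2 := by
  have h : l ^ 2 * y ^ 2 / (2 * c) - c / 2 * w ^ 2 - (l * w * y - c * w ^ 2)
      = (l * y - c * w) ^ 2 / (2 * c) := by
    field_simp
    ring
  have : 0 ≤ (l * y - c * w) ^ 2 / (2 * c) := by positivity
  linarith


/-- repulsion part of Observation SAM_SDE_Converg: the generator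
quantity `G` of the DNSAM Lyapunov computation tends to `-∞` as `x → 0` away from `0`;
in particular it is negative on a punctured ball around the origin. -/
theorem dnsam_generator_tendsto_atBot_near_origin
    (d : ℕ) (hd : 1 ≤ d) (lam : Fin d → ℝ) (hlam : ∀ i, lam i ≠ 0)
    (k : Fin d → ℝ) (hk : ∀ i, 0 < k i)
    (ρ η ς : ℝ) (hρ : 0 < ρ) (hη : 0 < η) (hς : 0 < ς)
    (H : EuclideanSpace ℝ (Fin d) → EuclideanSpace ℝ (Fin d))
    (hH : ∀ x i, H x i = lam i * x i)
    (G : EuclideanSpace ℝ (Fin d) → ℝ)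
    (hG : ∀ x, G x =
      (1 / 2) * ∑ i, k i * (x i) ^ 2
        + ∑ i, k i * lam i * (1 + ρ * lam i / ‖H x‖) * (x i) ^ 2
        - (η * ς ^ 2 / 2) * ∑ i, k i * (1 + ρ * lam i / ‖H x‖) ^ 2) :
    Filter.Tendsto G (nhdsWithin 0 {(0 : EuclideanSpace ℝ (Fin d))}ᶜ) Filter.atBot ∧
      ∃ ε > 0, ∀ x : EuclideanSpace ℝ (Fin d), x ≠ 0 → ‖x‖ < ε → G x < 0 := by
  have htend : Tendsto G (𝓝[≠] 0) atBot := by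
    let j : Fin d := ⟨0, hd⟩
    set c : ℝ := η * ς ^ 2 / 2
    have hc : 0 < c := by positivity
    let F : EuclideanSpace ℝ (Fin d) → ℝ := fun x =>
      ∑ i, k i * (x i ^ 2 / 2 + lam i ^ 2 * (x i ^ 2) ^ 2 / (2 * c))
    have hF : Tendsto F (𝓝[≠] 0) (𝓝 (F 0)) := by
      have hcont : Continuous F := by fun_prop
      exact (hcont.tendsto 0).mono_left nhdsWithin_le_nhds
    have hw : Tendsto (fun x => (1 + ρ * lam j * ‖H x‖⁻¹) ^ 2) (𝓝[≠] 0) atTop :=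
      (tendsto_one_add_mul_sq_atTop (mul_ne_zero hρ.ne' (hlam j))).comp
        (tendsto_norm_inv_diagonal_atTop hlam hH)
    have hkc : 0 < c / 2 * k j := mul_pos (by positivity) (hk j)
    refine tendsto_atBot_mono (fun x => ?_)
      (hF.add_atBot (tendsto_neg_atTop_atBot.comp (hw.const_mul_atTop hkc)))
    have hterm : G x ≤ F x - c / 2 * ∑ i, k i * (1 + ρ * lam i / ‖H x‖) ^ 2 := by
      simp only [hG, F, Finset.mul_sum, ← Finset.sum_add_distrib, ← Finset.sum_sub_distrib]
      refine Finset.sum_le_sum fun i _ => ?_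
      have := mul_le_mul_of_nonneg_left
        (quadratic_drift_le hc (lam i) (1 + ρ * lam i / ‖H x‖) (x i ^ 2)) (hk i).le
      linarith
    have hsingle : k j * (1 + ρ * lam j / ‖H x‖) ^ 2
        ≤ ∑ i, k i * (1 + ρ * lam i / ‖H x‖) ^ 2 :=
      Finset.single_le_sum (f := fun i => k i * (1 + ρ * lam i / ‖H x‖) ^ 2)
        (fun i _ => mul_nonneg (hk i).le (sq_nonneg _)) (Finset.mem_univ j)
    have := mul_le_mul_of_nonneg_left hsingle (by positivity : 0 ≤ c / 2)
    simp only [Function.comp_apply, ← div_eq_mul_inv]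
    linarith
  refine ⟨htend, ?_⟩
  obtain ⟨ε, hε, h⟩ := Metric.mem_nhdsWithin_iff.1 (htend.eventually_lt_atBot 0)
  exact ⟨ε, hε, fun x hx hxε => h ⟨by simpa using hxε, hx⟩⟩
end

section
/- Let E be a finite-dimensional real inner product space, N ≥ 1, and let f_i : E → ℝ for i ∈ Fin N be differentiable with each gradient ∇f_i L-Lipschitz and satisfying ‖∇f_i(y)‖ ≤ M(1 + ‖y‖) for all y, where L, M ≥ 0; set f = (1/N) Σ_i f_i. Then for every ρ ≥ 0 and every x ∈ E, the expected USAM search direction satisfies ‖(1/N) Σ_i ∇f_i(x + ρ∇f_i(x)) − ∇f(x)‖ ≤ L·M·ρ·(1 + ‖x‖). -/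
/-- The gradient of a scaled finite sum is the scaled sum of the gradients. -/
theorem hasGradientAt_const_mul_sum {ι E : Type*} [Fintype ι] [NormedAddCommGroup E]
    [InnerProductSpace ℝ E] [CompleteSpace E] {g : ι → E → ℝ} {x : E}
    (hg : ∀ i, DifferentiableAt ℝ (g i) x) (c : ℝ) :
    HasGradientAt (fun y => c * ∑ i, g i y) (c • ∑ i, gradient (g i) x) x := by
  rw [hasGradientAt_iff_hasFDerivAt, map_smulₛₗ, map_sum]
  exact (HasFDerivAt.fun_sum fun i _ => (hg i).hasGradientAt.hasFDerivAt).const_mul c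

/-- first-moment computation of Lemma USAM_SGD: the expected USAM
search direction differs from the full gradient by at most `L M ρ (1 + ‖x‖)`. -/
theorem usam_expected_drift_close_to_gradient
    {E : Type*} [NormedAddCommGroup E] [InnerProductSpace ℝ E] [FiniteDimensional ℝ E]
    (N : ℕ) (hN : 1 ≤ N) (fi : Fin N → E → ℝ) (hdiff : ∀ i, Differentiable ℝ (fi i))
    (L M : ℝ) (hL : 0 ≤ L) (hM : 0 ≤ M)
    (hLip : ∀ i, ∀ a b : E, ‖gradient (fi i) a - gradient (fi i) b‖ ≤ L * ‖a - b‖)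
    (hGrowth : ∀ i, ∀ y : E, ‖gradient (fi i) y‖ ≤ M * (1 + ‖y‖))
    (f : E → ℝ) (hf : ∀ y, f y = (1 / N : ℝ) * ∑ i, fi i y)
    (ρ : ℝ) (hρ : 0 ≤ ρ) (x : E) :
    ‖(1 / N : ℝ) • (∑ i, gradient (fi i) (x + ρ • gradient (fi i) x)) - gradient f x‖ ≤
      L * M * ρ * (1 + ‖x‖) := by
  obtain rfl : f = fun y => (1 / N : ℝ) * ∑ i, fi i y := funext hf
  rw [(hasGradientAt_const_mul_sum (fun i => hdiff i x) _).gradient, ← smul_sub,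
    ← Finset.sum_sub_distrib, norm_smul, Real.norm_of_nonneg (by positivity)]
  have hterm : ∀ i, ‖gradient (fi i) (x + ρ • gradient (fi i) x) - gradient (fi i) x‖ ≤
      L * M * ρ * (1 + ‖x‖) := fun i => calc
    _ ≤ L * ‖x + ρ • gradient (fi i) x - x‖ := hLip i _ _
    _ = L * (ρ * ‖gradient (fi i) x‖) := by
      rw [add_sub_cancel_left, norm_smul, Real.norm_of_nonneg hρ]
    _ ≤ L * (ρ * (M * (1 + ‖x‖))) := by gcongr; exact hGrowth i x
    _ = L * M * ρ * (1 + ‖x‖) := by ring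
  have hN0 : (N : ℝ) ≠ 0 := by exact_mod_cast (by lia : N ≠ 0)
  calc (1 / N : ℝ) * ‖∑ i, (gradient (fi i) (x + ρ • gradient (fi i) x) - gradient (fi i) x)‖
      ≤ (1 / N : ℝ) * ∑ _i : Fin N, L * M * ρ * (1 + ‖x‖) := by
        gcongr
        exact norm_sum_le_of_le _ fun i _ => hterm i
    _ = L * M * ρ * (1 + ‖x‖) := by
      rw [Finset.sum_const, Finset.card_univ, Fintype.card_fin, nsmul_eq_mul]
      field_simp
end

section
/- Let E be a finite-dimensional real inner product space, N ≥ 1, f : E → ℝ twice continuously differentiable, and z : Fin N → E with (1/N) Σ_i z i = 0. Define f_i(y) := f(y) + ⟨z i, y⟩, so that ∇f_i = ∇f + z i and ∇²f_i = ∇²f. For u, v ∈ E let outer(u,v) be the linear map w ↦ ⟨v, w⟩·u. Then for every x ∈ E, the USAM noise-interaction covariance Σ̃(x) := (1/N) Σ_i outer( ∇f(x) − ∇f_i(x), (1/N) Σ_j (∇²f_j(x))(∇f_j(x)) − (∇²f_i(x))(∇f_i(x)) ) equals Σ^{SGD}(x) ∘ ∇²f(x), where Σ^{SGD}(x) :=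 (1/N) Σ_i outer(∇f(x) − ∇f_i(x), ∇f(x) − ∇f_i(x)) = (1/N) Σ_i outer(z i, z i) and ∇²f(x) is the self-adjoint linear map given by the second derivative of f at x. -/
open RealInnerProductSpace in
/-- The derivative of the gradient represents the second Fréchet derivative. -/
theorem inner_fderiv_gradient {E : Type*} [NormedAddCommGroup E] [InnerProductSpace ℝ E]
    [CompleteSpace E] {f : E → ℝ} {x : E} (hf : DifferentiableAt ℝ (fderiv ℝ f) x) (v w : E) :
    ⟪fderiv ℝ (gradient f) x v, w⟫ = fderiv ℝ (fderiv ℝ f) x v w := by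
  let L : StrongDual ℝ E →L[ℝ] E :=
    { toFun := (InnerProductSpace.toDual ℝ E).symm
      map_add' := map_add _
      map_smul' := fun c φ => by simp
      cont := (InnerProductSpace.toDual ℝ E).symm.continuous }
  have h : HasFDerivAt (gradient f) (L.comp (fderiv ℝ (fderiv ℝ f) x)) x :=
    L.hasFDerivAt.comp x hf.hasFDerivAt
  rw [h.fderiv]
  exact InnerProductSpace.toDual_symm_apply

open RealInnerProductSpace in
/-- The derivative of the gradient of a `C²` function is self-adjoint. -/
theorem inner_fderiv_gradient_comm {E : Type*} [NormedAddCommGroup E] [InnerProductSpace ℝ E]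
    [CompleteSpace E] {f : E → ℝ} {x : E} (hf : ContDiffAt ℝ 2 f x) (v w : E) :
    ⟪fderiv ℝ (gradient f) x v, w⟫ = ⟪v, fderiv ℝ (gradient f) x w⟫ := by
  have hd : DifferentiableAt ℝ (fderiv ℝ f) x :=
    (hf.fderiv_right (m := 1) (by norm_num)).differentiableAt (by norm_num)
  rw [real_inner_comm _ v, inner_fderiv_gradient hd, inner_fderiv_gradient hd]
  exact hf.isSymmSndFDerivAt (by simp) v w

open RealInnerProductSpace in
/-- Adding the linear functional `⟪z, ·⟫` translates the gradient by `z`. -/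
theorem gradient_add_inner_left {E : Type*} [NormedAddCommGroup E] [InnerProductSpace ℝ E]
    [CompleteSpace E] {f : E → ℝ} {y : E} (hf : DifferentiableAt ℝ f y) (z : E) :
    gradient (fun y => f y + ⟪z, y⟫) y = gradient f y + z := by
  refine HasGradientAt.gradient ?_
  rw [hasGradientAt_iff_hasFDerivAt, map_add]
  exact hf.hasGradientAt.hasFDerivAt.add (InnerProductSpace.toDual ℝ E z).hasFDerivAt


open RealInnerProductSpace in
/-- Corollary USAM_SDE_Simplified: under constant additive gradient
noise `∇fᵢ = ∇f + zᵢ` with mean-zero `zᵢ`, the USAM noise-interaction covariance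
`Σ̃(x)` equals `Σ^{SGD}(x) ∘ ∇²f(x)` (as maps `E → E`, applied to any `w`). -/
theorem usam_noise_interaction_covariance_eq
    {E : Type*} [NormedAddCommGroup E] [InnerProductSpace ℝ E] [FiniteDimensional ℝ E]
    (N : ℕ) (hN : 1 ≤ N) (f : E → ℝ) (hf : ContDiff ℝ 2 f)
    (z : Fin N → E) (hz : (1 / N : ℝ) • ∑ i, z i = 0)
    (fi : Fin N → E → ℝ) (hfi : ∀ i y, fi i y = f y + ⟪z i, y⟫)
    (x : E) :
    ∀ w : E,
      (1 / N : ℝ) •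
          ∑ i, ⟪(1 / N : ℝ) •
                (∑ j, (fderiv ℝ (gradient (fi j)) x) (gradient (fi j) x)) -
              (fderiv ℝ (gradient (fi i)) x) (gradient (fi i) x), w⟫ •
            (gradient f x - gradient (fi i) x) =
        (1 / N : ℝ) •
          ∑ i, ⟪gradient f x - gradient (fi i) x, (fderiv ℝ (gradient f) x) w⟫ •
            (gradient f x - gradient (fi i) x) := by
  intro w
  have hgrad : ∀ i, gradient (fi i) = fun y => gradient f y + z i := fun i => by
    rw [funext (hfi i)]
    exact funext fun y => gradient_add_inner_left (hf.differentiable (by norm_num) y) (z i)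
  have hN' : (N : ℝ) ≠ 0 := by exact_mod_cast (by omega : N ≠ 0)
  have hmean : (1 / N : ℝ) • ∑ j, fderiv ℝ (gradient f) x (gradient f x + z j) =
      fderiv ℝ (gradient f) x (gradient f x) := by
    rw [← map_sum, ← map_smul, Finset.sum_add_distrib, smul_add, hz, add_zero]
    simp [← Nat.cast_smul_eq_nsmul ℝ, smul_smul, hN']
  simp only [hgrad, fderiv_add_const, hmean]
  congr 1
  refine Finset.sum_congr rfl fun i _ => ?_
  rw [← map_sub, inner_fderiv_gradient_comm hf.contDiffAt]
end
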